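/- arXiv:1408.6858 — 2 statements merged into one kernel-verified Lean document; each statement's English description precedes it below -/
import Mathlib

section
/- Let p be an odd prime such that the multiplicative order g of 2 in (ℤ/pℤ)^* is even. Let n = 2^b + 2^a where b > a ≥ 0 and n ≥ 9, and suppose that {a mod g, b mod g} = {0, g/2} (i.e. one of a, b is congruent to 0 and the other to g/2 modulo g). Then the cyclotomic polynomial Φ_{2p}(t) divides the descent set polynomial Q_n(t). -/
/-- The descent set of a permutation of `Fin n`, as a subset of `[n-1] = {1,…,n-1}`
(1-based positions): `i` is a descent if `π(i) > π(i+1)`. -/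
def descentSet (n : ℕ) (π : Equiv.Perm (Fin n)) : Finset ℕ :=
  (Finset.Ico 1 n).filter fun i => ∀ h : i < n, π ⟨i, h⟩ < π ⟨i - 1, by omega⟩

/-- The descent set statistic `β_n(S)`: the number of permutations of `{1,…,n}`
with descent set `S`. -/
def beta (n : ℕ) (S : Finset ℕ) : ℕ :=
  (Finset.univ.filter fun π : Equiv.Perm (Fin n) => descentSet n π = S).card

/-- The descent set polynomial `Q_n(t) = ∑_{S ⊆ [n-1]} t^{β_n(S)}`. -/
noncomputable def Q (n : ℕ) : Polynomial ℤ :=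
  ∑ S ∈ (Finset.Ico 1 n).powerset, Polynomial.X ^ beta n S


/-- The descent set of a word `f` of length `n` over a linear order, in 1-based positions. -/
def wordDescents {α : Type*} [LinearOrder α] {n : ℕ} (f : Fin n → α) : Finset ℕ :=
  (Finset.Ico 1 n).filter fun i => ∀ h : i < n, f ⟨i, h⟩ < f ⟨i - 1, by omega⟩

theorem mem_wordDescents {α : Type*} [LinearOrder α] {n : ℕ} {f : Fin n → α} {i : ℕ} :
    i ∈ wordDescents f ↔ ∃ h : 1 ≤ i ∧ i < n, f ⟨i, h.2⟩ < f ⟨i - 1, by omega⟩ := by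
  simp only [wordDescents, Finset.mem_filter, Finset.mem_Ico]
  exact ⟨fun h => ⟨h.1, h.2 h.1.2⟩, fun ⟨h, h'⟩ => ⟨h, fun _ => h'⟩⟩

theorem wordDescents_comp_strictMono {α γ : Type*} [LinearOrder α] [LinearOrder γ] {n : ℕ}
    (f : Fin n → α) {φ : α → γ} (hφ : StrictMono φ) :
    wordDescents (φ ∘ f) = wordDescents f := by
  ext i
  simp only [mem_wordDescents, Function.comp_apply, hφ.lt_iff_lt]

/-- `beta n S` counts the bijective words with descent set `S` over any linear order
with `n` elements. -/
theorem card_equiv_wordDescents_eq {α : Type*} [LinearOrder α] [Fintype α] {n : ℕ}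
    (hα : Fintype.card α = n) (S : Finset ℕ) :
    (Finset.univ.filter fun e : Fin n ≃ α => wordDescents e = S).card = beta n S := by
  let φ : Fin n ≃o α := Fintype.orderIsoFinOfCardEq α hα
  symm
  refine Finset.card_equiv (Equiv.equivCongr (Equiv.refl _) φ.toEquiv) fun π => ?_
  simp only [Finset.mem_filter, Finset.mem_univ, true_and]
  have : wordDescents (Equiv.equivCongr (Equiv.refl _) φ.toEquiv π) = descentSet n π :=
    wordDescents_comp_strictMono π φ.strictMono
  rw [this]

theorem beta_empty (n : ℕ) : beta n ∅ = 1 := by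
  rw [beta, Finset.card_eq_one]
  refine ⟨1, ?_⟩
  ext π
  simp only [Finset.mem_filter, Finset.mem_univ, true_and, Finset.mem_singleton]
  constructor
  · intro h
    have hmono : StrictMono π := by
      cases n with
      | zero => exact fun i => i.elim0
      | succ n =>
        rw [Fin.strictMono_iff_lt_succ]
        intro i
        have hi : (i : ℕ) + 1 ∉ wordDescents π := by
          change _ ∉ descentSet _ π
          simp [h]
        rw [mem_wordDescents] at hi
        push Not at hi
        exact lt_of_le_of_ne (hi ⟨by omega, by omega⟩)
          (π.injective.ne (Fin.castSucc_lt_succ).ne)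
    have : hmono.orderIsoOfSurjective π π.surjective = OrderIso.refl _ := Subsingleton.elim _ _
    ext i
    exact congrArg Fin.val (DFunLike.congr_fun this i)
  · rintro rfl
    ext i
    change i ∈ wordDescents _ ↔ _
    simp only [mem_wordDescents, Equiv.Perm.coe_one, id_eq, Fin.mk_lt_mk, Finset.notMem_empty,
      iff_false, not_exists]
    omega

/-- Concatenation of a bijection onto `A` with a bijection onto its complement. -/
def concatEquiv {k l : ℕ} (A : Finset (Fin (k + l)))
    (e : (Fin k ≃ {x // x ∈ A}) × (Fin l ≃ {x // x ∉ A})) : Equiv.Perm (Fin (k + l)) :=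
  finSumFinEquiv.symm.trans ((Equiv.sumCongr e.1 e.2).trans (Equiv.sumCompl (· ∈ A)))

theorem concatEquiv_castAdd {k l : ℕ} (A : Finset (Fin (k + l)))
    (e : (Fin k ≃ {x // x ∈ A}) × (Fin l ≃ {x // x ∉ A})) (i : Fin k) :
    concatEquiv A e (Fin.castAdd l i) = e.1 i := by
  simp [concatEquiv]

theorem concatEquiv_natAdd {k l : ℕ} (A : Finset (Fin (k + l)))
    (e : (Fin k ≃ {x // x ∈ A}) × (Fin l ≃ {x // x ∉ A})) (i : Fin l) :
    concatEquiv A e (Fin.natAdd k i) = e.2 i := by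
  simp [concatEquiv]

theorem erase_wordDescents_eq_iff {α : Type*} [LinearOrder α] {k l : ℕ} (f : Fin (k + l) → α)
    {S : Finset ℕ} (hS : S ⊆ Finset.Ico 1 (k + l)) :
    (wordDescents f).erase k = S.erase k ↔
      wordDescents (fun i : Fin k => f (Fin.castAdd l i)) = (Finset.Ico 1 k).filter (· ∈ S) ∧
      wordDescents (fun i : Fin l => f (Fin.natAdd k i)) =
        (Finset.Ico 1 l).filter (k + · ∈ S) := by
  have key₁ : ∀ i, i ∈ wordDescents (fun i : Fin k => f (Fin.castAdd l i)) ↔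
      i < k ∧ i ∈ wordDescents f := by
    intro i
    simp only [mem_wordDescents, Fin.castAdd_mk]
    exact ⟨fun ⟨h, h'⟩ => ⟨h.2, ⟨h.1, by omega⟩, h'⟩, fun ⟨h, h', h''⟩ => ⟨⟨h'.1, h⟩, h''⟩⟩
  have key₂ : ∀ i, i ∈ wordDescents (fun i : Fin l => f (Fin.natAdd k i)) ↔
      1 ≤ i ∧ k + i ∈ wordDescents f := by
    intro i
    simp only [mem_wordDescents, Fin.natAdd_mk]
    constructor
    · rintro ⟨h, h'⟩
      refine ⟨h.1, ⟨by omega, by omega⟩, ?_⟩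
      simpa only [Nat.add_sub_assoc h.1] using h'
    · rintro ⟨h, h', h''⟩
      refine ⟨⟨h, by omega⟩, ?_⟩
      simpa only [Nat.add_sub_assoc h] using h''
  simp only [Finset.ext_iff, key₁, key₂, Finset.mem_erase, Finset.mem_filter, Finset.mem_Ico]
  constructor
  · intro h
    refine ⟨fun i => ?_, fun i => ?_⟩
    · have h1 := h i
      have h2 := @hS i
      rw [Finset.mem_Ico] at h2
      grind
    · have h1 := h (k + i)
      have h2 := @hS (k + i)
      rw [Finset.mem_Ico] at h2
      grind
  · rintro ⟨h1, h2⟩ i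
    have h3 : i ∈ wordDescents f → 1 ≤ i ∧ i < k + l := fun h => (mem_wordDescents.1 h).1
    have h4 := @hS i
    rw [Finset.mem_Ico] at h4
    rcases lt_trichotomy i k with hi | hi | hi
    · have := h1 i
      grind
    · simp [hi]
    · obtain ⟨j, rfl⟩ := Nat.exists_eq_add_of_le hi.le
      have := h2 j
      grind

theorem image_castAdd_eq_iff {k l : ℕ} {A : Finset (Fin (k + l))} (hA : A.card = k)
    (π : Equiv.Perm (Fin (k + l))) :
    (Finset.univ.image fun i : Fin k => π (Fin.castAdd l i)) = A ↔
      ∃ e : (Fin k ≃ {x // x ∈ A}) × (Fin l ≃ {x // x ∉ A}), concatEquiv A e = π := by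
  constructor
  · intro h
    have hmem : ∀ i, π (Fin.castAdd l i) ∈ A := fun i =>
      h ▸ Finset.mem_image_of_mem _ (Finset.mem_univ i)
    have hnotMem : ∀ j, π (Fin.natAdd k j) ∉ A := by
      intro j hj
      rw [← h] at hj
      obtain ⟨i, -, hi⟩ := Finset.mem_image.1 hj
      have := congrArg Fin.val (π.injective hi)
      simp only [Fin.val_castAdd, Fin.val_natAdd] at this
      omega
    have h₁ : Function.Bijective fun i : Fin k => (⟨_, hmem i⟩ : {x // x ∈ A}) := by
      rw [Fintype.bijective_iff_injective_and_card]
      refine ⟨fun i j hij => ?_, by simp [hA]⟩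
      simpa using hij
    have h₂ : Function.Bijective fun i : Fin l => (⟨_, hnotMem i⟩ : {x // x ∉ A}) := by
      rw [Fintype.bijective_iff_injective_and_card]
      refine ⟨fun i j hij => ?_, by simp [Fintype.card_subtype_compl, hA]⟩
      simpa using hij
    refine ⟨(Equiv.ofBijective _ h₁, Equiv.ofBijective _ h₂), Equiv.ext fun i => ?_⟩
    induction i using Fin.addCases with
    | left i => rw [concatEquiv_castAdd]; rfl
    | right i => rw [concatEquiv_natAdd]; rfl
  · rintro ⟨e, rfl⟩
    refine Finset.eq_of_subset_of_card_le ?_ ?_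
    · intro x hx
      obtain ⟨i, -, rfl⟩ := Finset.mem_image.1 hx
      rw [concatEquiv_castAdd]
      exact (e.1 i).2
    · have hinj : Function.Injective fun i => concatEquiv A e (Fin.castAdd l i) :=
        (Equiv.injective _).comp (Fin.castAdd_injective k l)
      rw [Finset.card_image_of_injective _ hinj]
      simp [hA]

theorem concatEquiv_injective {k l : ℕ} (A : Finset (Fin (k + l))) :
    Function.Injective (concatEquiv A) := by
  intro e e' h
  refine Prod.ext (Equiv.ext fun i => ?_) (Equiv.ext fun i => ?_)
  · apply Subtype.ext
    rw [← concatEquiv_castAdd, ← concatEquiv_castAdd, h]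
  · apply Subtype.ext
    rw [← concatEquiv_natAdd, ← concatEquiv_natAdd, h]

theorem card_erase_descentSet_eq {k l : ℕ} {S : Finset ℕ} (hS : S ⊆ Finset.Ico 1 (k + l)) :
    (Finset.univ.filter fun π : Equiv.Perm (Fin (k + l)) =>
        (descentSet (k + l) π).erase k = S.erase k).card =
      (k + l).choose k * (beta k ((Finset.Ico 1 k).filter (· ∈ S)) *
        beta l ((Finset.Ico 1 l).filter (k + · ∈ S))) := by
  rw [Finset.card_eq_sum_card_fiberwise
    (f := fun π => Finset.univ.image fun i : Fin k => π (Fin.castAdd l i))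
    (t := Finset.powersetCard k Finset.univ)]
  · rw [Finset.sum_const_nat (m := beta k ((Finset.Ico 1 k).filter (· ∈ S)) *
        beta l ((Finset.Ico 1 l).filter (k + · ∈ S)))]
    · simp
    · intro A hA
      have hA := (Finset.mem_powersetCard.1 hA).2
      rw [← card_equiv_wordDescents_eq (α := {x // x ∈ A}) (by simp [hA]),
        ← card_equiv_wordDescents_eq (α := {x // x ∉ A})
          (by simp [Fintype.card_subtype_compl, hA]), ← Finset.card_product]
      symm
      have hdesc : ∀ e : (Fin k ≃ {x // x ∈ A}) × (Fin l ≃ {x // x ∉ A}),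
          (descentSet (k + l) (concatEquiv A e)).erase k = S.erase k ↔
            wordDescents e.1 = (Finset.Ico 1 k).filter (· ∈ S) ∧
            wordDescents e.2 = (Finset.Ico 1 l).filter (k + · ∈ S) := by
        intro e
        refine (erase_wordDescents_eq_iff (concatEquiv A e) hS).trans ?_
        simp only [concatEquiv_castAdd, concatEquiv_natAdd]
        rw [← wordDescents_comp_strictMono e.1 (Subtype.strictMono_coe _),
          ← wordDescents_comp_strictMono e.2 (Subtype.strictMono_coe _)]
        rfl
      refine Finset.card_bij (fun e _ => concatEquiv A e) ?_ ?_ ?_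
      · intro e he
        simp only [Finset.mem_product, Finset.mem_filter, Finset.mem_univ, true_and] at he ⊢
        exact ⟨(hdesc e).2 he, (image_castAdd_eq_iff hA _).2 ⟨e, rfl⟩⟩
      · exact fun e _ e' _ h => concatEquiv_injective A h
      · intro π hπ
        simp only [Finset.mem_filter, Finset.mem_univ, true_and] at hπ
        obtain ⟨e, rfl⟩ := (image_castAdd_eq_iff hA π).1 hπ.2
        refine ⟨e, ?_, rfl⟩
        simpa only [Finset.mem_product, Finset.mem_filter, Finset.mem_univ, true_and]
          using (hdesc e).1 hπ.1
  · intro π _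
    have hinj : Function.Injective fun i => π (Fin.castAdd l i) :=
      π.injective.comp (Fin.castAdd_injective k l)
    simp only [Finset.mem_coe, Finset.mem_powersetCard, Finset.subset_univ, true_and]
    rw [Finset.card_image_of_injective _ hinj]
    simp

/-- Toggling the membership of `k` in a descent set: the two statistics add up to a product. -/
theorem beta_add_beta_symmDiff {n k l : ℕ} (hn : n = k + l) {S : Finset ℕ}
    (hS : S ⊆ Finset.Ico 1 n) :
    beta n S + beta n (symmDiff S {k}) =
      n.choose k * (beta k ((Finset.Ico 1 k).filter (· ∈ S)) *
        beta l ((Finset.Ico 1 l).filter (k + · ∈ S))) := by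
  subst hn
  rw [← card_erase_descentSet_eq hS, beta, beta, ← Finset.card_union_of_disjoint]
  · congr 1
    ext π
    simp only [Finset.mem_union, Finset.mem_filter, Finset.mem_univ, true_and]
    simp only [Finset.ext_iff, Finset.mem_symmDiff, Finset.mem_singleton, Finset.mem_erase]
    by_cases h : k ∈ descentSet (k + l) π ↔ k ∈ S
    · constructor
      · rintro (h1 | h1) i
        · simp [h1]
        · have := h1 i
          grind
      · intro h1
        left
        intro i
        by_cases hi : i = k
        · exact hi ▸ h
        · simpa [hi] using h1 i
    · constructor
      · rintro (h1 | h1) i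
        · simp [h1]
        · have := h1 i
          grind
      · intro h1
        right
        intro i
        by_cases hi : i = k
        · subst hi
          grind
        · simpa [hi] using h1 i
  · rw [Finset.disjoint_filter]
    rintro π - h h'
    have h0 : k ∈ S ↔ k ∈ symmDiff S {k} := by rw [← h', h]
    simp [Finset.mem_symmDiff] at h0

theorem odd_beta_two_pow (a : ℕ) {S : Finset ℕ} (hS : S ⊆ Finset.Ico 1 (2 ^ a)) :
    Odd (beta (2 ^ a) S) := by
  induction S using Finset.induction_on with
  | empty => simp [beta_empty]
  | insert k S hk ih =>
    have hS' := (Finset.subset_insert k S).trans hS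
    have hk' := Finset.mem_Ico.1 (hS (Finset.mem_insert_self k S))
    have h := beta_add_beta_symmDiff (show 2 ^ a = k + (2 ^ a - k) by omega) hS'
    have hins : symmDiff S {k} = insert k S := by
      ext i
      simp only [Finset.mem_symmDiff, Finset.mem_singleton, Finset.mem_insert]
      grind
    have hev : Even ((2 ^ a).choose k) :=
      even_iff_two_dvd.2 (Nat.prime_two.dvd_choose_pow (by omega) (by omega))
    rw [hins] at h
    have := h ▸ hev.mul_right _
    rw [Nat.even_add', iff_comm] at this
    exact this.2 (ih hS')

theorem choose_two_pow_add_two_pow (a b k : ℕ) :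
    (((2 ^ b + 2 ^ a).choose k : ℕ) : ZMod 2) =
      (if k = 0 then 1 else 0) + (if k = 2 ^ a then 1 else 0) + (if k = 2 ^ b then 1 else 0)
        + (if k = 2 ^ b + 2 ^ a then 1 else 0) := by
  have h : (1 + Polynomial.X : Polynomial (ZMod 2)) ^ (2 ^ b + 2 ^ a) =
      1 + Polynomial.X ^ 2 ^ a + Polynomial.X ^ 2 ^ b + Polynomial.X ^ (2 ^ b + 2 ^ a) := by
    rw [pow_add, add_pow_char_pow, add_pow_char_pow]
    ring
  rw [← Polynomial.coeff_one_add_X_pow, h]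
  simp only [Polynomial.coeff_add, Polynomial.coeff_X_pow, Polynomial.coeff_one]

theorem Nat.Prime.dvd_choose_of_dvd_of_not_dvd {p n k : ℕ} (hp : p.Prime) (hn : p ∣ n)
    (hk : ¬ p ∣ k) : p ∣ n.choose k := by
  cases k with
  | zero => simp at hk
  | succ k =>
    cases n with
    | zero => simp
    | succ n =>
      have h : p ∣ (n + 1).choose (k + 1) * (k + 1) :=
        Nat.add_one_mul_choose_eq n k ▸ hn.mul_right _
      exact (hp.dvd_mul.1 h).resolve_right hk

theorem sum_powerset_symmDiff_singleton {M : Type*} [AddCommMonoid M] {T : Finset ℕ} {k : ℕ}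
    (hk : k ∈ T) (f : Finset ℕ → M) :
    ∑ S ∈ T.powerset, f (symmDiff S {k}) = ∑ S ∈ T.powerset, f S := by
  have hmem : ∀ S ∈ T.powerset, symmDiff S {k} ∈ T.powerset := by
    intro S hS
    rw [Finset.mem_powerset] at hS ⊢
    intro i hi
    rw [Finset.mem_symmDiff, Finset.mem_singleton] at hi
    rcases hi with hi | hi
    · exact hS hi.1
    · exact hi.1 ▸ hk
  exact Finset.sum_nbij' (symmDiff · {k}) (symmDiff · {k}) hmem hmem
    (fun S _ => symmDiff_symmDiff_cancel_right _ _) (fun S _ => symmDiff_symmDiff_cancel_right _ _)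
    (fun _ _ => rfl)

/-- If toggling `k` always multiplies to the constant `c`, then the sum of the powers
is `c` times the sum of the inverse powers. -/
theorem sum_pow_beta_eq {K : Type*} [Field K] {n k : ℕ} {ω c : K} (hω : ω ≠ 0)
    (hk : k ∈ Finset.Ico 1 n)
    (h : ∀ S ⊆ Finset.Ico 1 n, ω ^ (beta n S + beta n (symmDiff S {k})) = c) :
    ∑ S ∈ (Finset.Ico 1 n).powerset, ω ^ beta n S =
      c * ∑ S ∈ (Finset.Ico 1 n).powerset, (ω ^ beta n S)⁻¹ := by
  rw [← sum_powerset_symmDiff_singleton hk, Finset.mul_sum]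
  refine Finset.sum_congr rfl fun S hS => ?_
  rw [← h S (Finset.mem_powerset.1 hS), pow_add]
  have := pow_ne_zero (beta n S) hω
  field_simp

theorem two_pow_half_orderOf_eq_neg_one {p : ℕ} (hp : p.Prime) (hpodd : Odd p)
    (hg : Even (orderOf (2 : ZMod p))) : (2 : ZMod p) ^ (orderOf (2 : ZMod p) / 2) = -1 := by
  have := Fact.mk hp
  have h2 : (2 : ZMod p) ≠ 0 := by
    intro h
    have h' : ((2 : ℕ) : ZMod p) = 0 := by exact_mod_cast h
    rw [ZMod.natCast_eq_zero_iff, Nat.prime_dvd_prime_iff_eq hp Nat.prime_two] at h'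
    subst h'
    exact absurd hpodd (by decide)
  have hpos : 0 < orderOf (2 : ZMod p) :=
    orderOf_pos_iff.2 (isOfFinOrder_iff_pow_eq_one.2
      ⟨p - 1, Nat.sub_pos_of_lt hp.one_lt, ZMod.pow_card_sub_one_eq_one h2⟩)
  obtain ⟨r, hr⟩ := hg
  have hsq : ((2 : ZMod p) ^ (orderOf (2 : ZMod p) / 2)) ^ 2 = 1 := by
    rw [← pow_mul, Nat.div_mul_cancel (by omega), pow_orderOf_eq_one]
  exact (sq_eq_one_iff.1 hsq).resolve_left
    (pow_ne_one_of_lt_orderOf (by omega) (by omega))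

theorem dvd_two_pow_add_two_pow {p a b : ℕ} (hp : p.Prime) (hpodd : Odd p)
    (hg : Even (orderOf (2 : ZMod p)))
    (h : ({a % orderOf (2 : ZMod p), b % orderOf (2 : ZMod p)} : Multiset ℕ) =
      {0, orderOf (2 : ZMod p) / 2}) :
    p ∣ 2 ^ b + 2 ^ a := by
  have hneg := two_pow_half_orderOf_eq_neg_one hp hpodd hg
  rw [← ZMod.natCast_eq_zero_iff]
  push_cast
  rw [← pow_mod_orderOf 2 a, ← pow_mod_orderOf 2 b]
  rcases Multiset.cons_eq_cons.1 h with ⟨h₁, h₂⟩ | ⟨-, c, h₁, h₂⟩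
  · rw [h₁, Multiset.singleton_inj.1 h₂, hneg]; simp
  · rw [Multiset.singleton_eq_cons_iff] at h₁ h₂
    rw [h₁.1, ← h₂.1, hneg]; simp

theorem exists_not_dvd_ne_two_pow {p n a b : ℕ} (hp : p.Prime) (hpodd : Odd p) (hn : 5 ≤ n) :
    ∃ k, k ∈ Finset.Ico 1 n ∧ ¬ p ∣ k ∧ k ≠ 2 ^ a ∧ k ≠ 2 ^ b := by
  have hpow : ∀ i, ¬ p ∣ 2 ^ i := fun i h => by
    have := (Nat.prime_dvd_prime_iff_eq hp Nat.prime_two).1 (hp.dvd_of_dvd_pow h)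
    subst this
    exact absurd hpodd (by decide)
  have h1 := hpow 0
  have h2 := hpow 1
  have h4 := hpow 2
  norm_num at h1 h2 h4
  simp only [Finset.mem_Ico]
  by_cases c1 : 1 ≠ 2 ^ a ∧ 1 ≠ 2 ^ b
  · exact ⟨1, by omega, by simpa using h1, c1⟩
  by_cases c2 : 2 ≠ 2 ^ a ∧ 2 ≠ 2 ^ b
  · exact ⟨2, by omega, h2, c2⟩
  exact ⟨4, by omega, h4, by omega⟩

theorem cyclotomic_dvd_of_aeval_eq_zero {m : ℕ} (hm : 0 < m) {ω : ℂ} (hω : IsPrimitiveRoot ω m)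
    {f : Polynomial ℤ} (hf : Polynomial.aeval ω f = 0) : Polynomial.cyclotomic m ℤ ∣ f := by
  rw [Polynomial.cyclotomic_eq_minpoly hω hm]
  exact minpoly.isIntegrallyClosed_dvd (hω.isIntegral hm) hf

/-- Let `p` be an odd prime for which the multiplicative order `g` of `2` modulo
`p` is even, and let `n = 2^b + 2^a` with `b > a ≥ 0` and `n ≥ 9`. If one of
`a, b` is `≡ 0` and the other `≡ g/2` modulo `g`, then `Φ_{2p}` divides
`Q_n(t)`. -/
theorem cyclotomic_two_p_dvd_even_order_one (p a b g : ℕ) (hp : p.Prime) (hpodd : Odd p)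
    (hg : g = orderOf (2 : ZMod p)) (hgeven : Even g)
    (hab : a < b) (hn : 9 ≤ 2 ^ b + 2 ^ a)
    (hcong : ({a % g, b % g} : Multiset ℕ) = {0, g / 2}) :
    Polynomial.cyclotomic (2 * p) ℤ ∣ Q (2 ^ b + 2 ^ a) := by
  subst hg
  have hpn := dvd_two_pow_add_two_pow hp hpodd hgeven hcong
  have hlt : 2 ^ a < 2 ^ b := Nat.pow_lt_pow_right (by norm_num) hab
  have hapos : 0 < 2 ^ a := by positivity
  have h2p : 0 < 2 * p := by have := hp.pos; omega
  have hω := Complex.isPrimitiveRoot_exp (2 * p) h2p.ne'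
  set ω := Complex.exp (2 * Real.pi * Complex.I / ((2 * p : ℕ) : ℂ))
  have hω0 : ω ≠ 0 := hω.ne_zero h2p.ne'
  have hωp : ω ^ p = -1 := (hω.pow h2p (mul_comm 2 p)).eq_neg_one_of_two_right
  refine cyclotomic_dvd_of_aeval_eq_zero h2p hω ?_
  simp only [Q, map_sum, map_pow, Polynomial.aeval_X]
  obtain ⟨k, hk, hpk, hka, hkb⟩ := exists_not_dvd_ne_two_pow (a := a) (b := b) hp hpodd
    (show 5 ≤ 2 ^ b + 2 ^ a by omega)
  have hpos := sum_pow_beta_eq (c := 1) hω0 hk fun S hS => by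
    rw [Finset.mem_Ico] at hk
    rw [beta_add_beta_symmDiff (l := 2 ^ b + 2 ^ a - k) (by omega) hS, hω.pow_eq_one_iff_dvd]
    refine Dvd.dvd.mul_right ?_ _
    refine Nat.Coprime.mul_dvd_of_dvd_of_dvd (Nat.coprime_two_left.2 hpodd) ?_
      (hp.dvd_choose_of_dvd_of_not_dvd hpn hpk)
    rw [← ZMod.natCast_eq_zero_iff, choose_two_pow_add_two_pow]
    simp [hka, hkb, hk.2.ne, show k ≠ 0 by omega]
  have hpa : ¬ p ∣ 2 ^ a := fun h => by
    have := (Nat.prime_dvd_prime_iff_eq hp Nat.prime_two).1 (hp.dvd_of_dvd_pow h)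
    subst this
    exact absurd hpodd (by decide)
  have hneg := sum_pow_beta_eq (n := 2 ^ b + 2 ^ a) (k := 2 ^ a) (c := -1) hω0
    (Finset.mem_Ico.2 (by omega)) fun S hS => by
    rw [beta_add_beta_symmDiff (add_comm (2 ^ b) (2 ^ a)) hS]
    obtain ⟨c, hc⟩ := hp.dvd_choose_of_dvd_of_not_dvd hpn hpa
    have hodd : Odd ((2 ^ b + 2 ^ a).choose (2 ^ a)) := by
      rw [← ZMod.natCast_eq_one_iff_odd, choose_two_pow_add_two_pow]
      simp [hlt.ne]
    have hcodd : Odd c := by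
      rw [hc] at hodd
      exact (Nat.odd_mul.1 hodd).2
    rw [hc, mul_assoc, pow_mul, hωp]
    exact (hcodd.mul ((odd_beta_two_pow a (Finset.filter_subset _ _)).mul
      (odd_beta_two_pow b (Finset.filter_subset _ _)))).neg_one_pow
  linear_combination (hpos + hneg) / 2
end

section
/- The cyclotomic polynomial Φ_6(t) = t^2 − t + 1 divides the descent set polynomial Q_{11}(t). -/
open Finset Polynomial

/-- The permutation of `Fin (n + 1)` with last value `p` whose remaining values are ordered
as those of `σ`. -/
def appendLast {n : ℕ} (p : Fin (n + 1)) (σ : Equiv.Perm (Fin n)) : Equiv.Perm (Fin (n + 1)) :=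
  (finSuccEquivLast.trans (Equiv.optionCongr σ)).trans (finSuccEquiv' p).symm

lemma appendLast_last {n : ℕ} (p : Fin (n + 1)) (σ : Equiv.Perm (Fin n)) :
    appendLast p σ (Fin.last n) = p := by
  simp [appendLast]

lemma appendLast_castSucc {n : ℕ} (p : Fin (n + 1)) (σ : Equiv.Perm (Fin n)) (i : Fin n) :
    appendLast p σ i.castSucc = p.succAbove (σ i) := by
  simp [appendLast]

lemma appendLast_injective {n : ℕ} :
    Function.Injective fun x : Fin (n + 1) × Equiv.Perm (Fin n) => appendLast x.1 x.2 := by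
  rintro ⟨p, σ⟩ ⟨q, τ⟩ h
  simp only at h
  obtain rfl : p = q := by rw [← appendLast_last p σ, h, appendLast_last]
  refine Prod.ext rfl (Equiv.ext fun i => ?_)
  apply Fin.succAbove_right_injective (p := p)
  rw [← appendLast_castSucc, h, appendLast_castSucc]

lemma exists_appendLast {n : ℕ} (π : Equiv.Perm (Fin (n + 1))) :
    ∃ σ, appendLast (π (Fin.last n)) σ = π := by
  have hb := (Fintype.bijective_iff_injective_and_card _).2
    ⟨appendLast_injective (n := n), by simp [Fintype.card_perm, Nat.factorial_succ]⟩
  obtain ⟨⟨p, σ⟩, rfl⟩ := hb.2 π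
  exact ⟨σ, by simp only [appendLast_last]⟩

lemma mem_descentSet {n : ℕ} {π : Equiv.Perm (Fin n)} {i : ℕ} :
    i ∈ descentSet n π ↔
      (1 ≤ i ∧ i < n) ∧ ∀ h : i < n, π ⟨i, h⟩ < π ⟨i - 1, by omega⟩ := by
  simp [descentSet]

lemma lt_of_mem_descentSet {n : ℕ} {π : Equiv.Perm (Fin n)} {i : ℕ} (h : i ∈ descentSet n π) :
    i < n :=
  (mem_descentSet.1 h).1.2

lemma mem_descentSet_appendLast_iff {n : ℕ} (p : Fin (n + 1)) (σ : Equiv.Perm (Fin n)) {i : ℕ}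
    (hi : i < n) : i ∈ descentSet (n + 1) (appendLast p σ) ↔ i ∈ descentSet n σ := by
  have h1 := appendLast_castSucc p σ ⟨i, hi⟩
  have h2 := appendLast_castSucc p σ ⟨i - 1, by omega⟩
  simp only [Fin.castSucc_mk] at h1 h2
  simp [mem_descentSet, h1, h2, hi, Nat.lt_succ_of_lt hi]

lemma last_mem_descentSet_appendLast_iff {n : ℕ} (p : Fin (n + 2))
    (σ : Equiv.Perm (Fin (n + 1))) :
    n + 1 ∈ descentSet (n + 2) (appendLast p σ) ↔ (p : ℕ) ≤ σ (Fin.last n) := by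
  have h1 := appendLast_last p σ
  have h2 := appendLast_castSucc p σ (Fin.last n)
  simp only [Fin.last, Fin.castSucc_mk] at h1 h2
  simp [mem_descentSet, h1, h2, Fin.lt_succAbove_iff_le_castSucc, Fin.le_def, Fin.last]

lemma descentSet_appendLast_eq_iff {n : ℕ} (p : Fin (n + 2)) (σ : Equiv.Perm (Fin (n + 1)))
    {S : Finset ℕ} (hS : n + 1 ∉ S) :
    descentSet (n + 2) (appendLast p σ) = S ↔
      descentSet (n + 1) σ = S ∧ (σ (Fin.last n) : ℕ) < p := by
  have hl := last_mem_descentSet_appendLast_iff p σ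
  have hm := fun i (hi : i < n + 1) => mem_descentSet_appendLast_iff p σ hi
  have hlt := fun i => lt_of_mem_descentSet (π := σ) (i := i)
  have hlt' := fun i => lt_of_mem_descentSet (π := appendLast p σ) (i := i)
  constructor
  · rintro rfl
    refine ⟨?_, by grind⟩
    ext i
    by_cases hi : i < n + 1
    · exact (hm i hi).symm
    · grind
  · rintro ⟨rfl, h⟩
    ext i
    by_cases hi : i < n + 1
    · exact hm i hi
    · grind

lemma descentSet_appendLast_eq_insert_iff {n : ℕ} (p : Fin (n + 2))
    (σ : Equiv.Perm (Fin (n + 1))) {S : Finset ℕ} (hS : n + 1 ∉ S) :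
    descentSet (n + 2) (appendLast p σ) = insert (n + 1) S ↔
      descentSet (n + 1) σ = S ∧ (p : ℕ) ≤ σ (Fin.last n) := by
  have hl := last_mem_descentSet_appendLast_iff p σ
  have hm := fun i (hi : i < n + 1) => mem_descentSet_appendLast_iff p σ hi
  have hlt := fun i => lt_of_mem_descentSet (π := σ) (i := i)
  have hlt' := fun i => lt_of_mem_descentSet (π := appendLast p σ) (i := i)
  constructor
  · intro h
    refine ⟨?_, by grind⟩
    ext i
    by_cases hi : i < n + 1
    · rw [← hm i hi, h]
      grind
    · grind
  · rintro ⟨rfl, h⟩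
    ext i
    by_cases hi : i < n + 1
    · grind
    · grind

/-- The number of permutations of `Fin (n + 1)` with descent set `S` and last value `q`. -/
def betaLast (n : ℕ) (S : Finset ℕ) (q : ℕ) : ℕ :=
  #{π : Equiv.Perm (Fin (n + 1)) | descentSet (n + 1) π = S ∧ (π (Fin.last n) : ℕ) = q}

lemma betaLast_succ_eq_card (n : ℕ) (S : Finset ℕ) (p : Fin (n + 2)) :
    betaLast (n + 1) S p =
      #{σ : Equiv.Perm (Fin (n + 1)) | descentSet (n + 2) (appendLast p σ) = S} := by
  symm
  refine card_bij (fun σ _ => appendLast p σ) ?_ ?_ ?_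
  · intro σ hσ
    simpa [appendLast_last] using hσ
  · intro σ _ τ _ h
    exact (Prod.ext_iff.1 (appendLast_injective (a₁ := (p, σ)) (a₂ := (p, τ)) h)).2
  · intro π hπ
    obtain ⟨hS, hp⟩ := (mem_filter.1 hπ).2
    obtain ⟨σ, hσ⟩ := exists_appendLast π
    rw [Fin.ext hp] at hσ
    exact ⟨σ, by simp [hσ, hS], hσ⟩

lemma sum_betaLast (n : ℕ) (S t : Finset ℕ) :
    ∑ q ∈ t, betaLast n S q =
      #{σ : Equiv.Perm (Fin (n + 1)) |
        descentSet (n + 1) σ = S ∧ (σ (Fin.last n) : ℕ) ∈ t} := by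
  rw [card_eq_sum_card_fiberwise (f := fun σ => (σ (Fin.last n) : ℕ)) (t := t)]
  · refine sum_congr rfl fun q hq => congrArg card ?_
    ext σ
    simp only [mem_filter, mem_univ, true_and]
    constructor
    · rintro ⟨h, rfl⟩
      exact ⟨⟨h, hq⟩, rfl⟩
    · rintro ⟨⟨h, -⟩, h'⟩
      exact ⟨h, h'⟩
  · intro σ hσ
    simp only [coe_filter, mem_univ, true_and, Set.mem_ofPred_eq] at hσ
    exact hσ.2

lemma betaLast_succ (n : ℕ) {S : Finset ℕ} (hS : n + 1 ∉ S) (p : Fin (n + 2)) :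
    betaLast (n + 1) S p = ∑ q ∈ range p, betaLast n S q := by
  simp [betaLast_succ_eq_card, sum_betaLast, descentSet_appendLast_eq_iff p _ hS]

lemma betaLast_succ_insert (n : ℕ) {S : Finset ℕ} (hS : n + 1 ∉ S) (p : Fin (n + 2)) :
    betaLast (n + 1) (insert (n + 1) S) p = ∑ q ∈ Ico (p : ℕ) (n + 1), betaLast n S q := by
  simp [betaLast_succ_eq_card, sum_betaLast, descentSet_appendLast_eq_insert_iff p _ hS,
    Fin.is_le]

lemma beta_succ (n : ℕ) (S : Finset ℕ) :
    beta (n + 1) S = ∑ q ∈ range (n + 1), betaLast n S q := by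
  simp [beta, sum_betaLast, Fin.is_le]

/-- The values `betaLast n S q` for `q = 0, …, n`. -/
def betaList (n : ℕ) (S : Finset ℕ) : List ℕ :=
  (List.range (n + 1)).map (betaLast n S)

def prefixSums (l : List ℕ) : List ℕ :=
  (List.range (l.length + 1)).map fun p => (l.take p).sum

def suffixSums (l : List ℕ) : List ℕ :=
  (List.range (l.length + 1)).map fun p => (l.drop p).sum

lemma betaList_succ (n : ℕ) {S : Finset ℕ} (hS : n + 1 ∉ S) :
    betaList (n + 1) S = prefixSums (betaList n S) := by
  simp only [betaList, prefixSums, List.length_map, List.length_range]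
  refine List.map_congr_left fun p hp => ?_
  rw [List.mem_range] at hp
  rw [betaLast_succ n hS ⟨p, hp⟩, ← List.map_take, List.take_range, min_eq_left (by omega)]
  simp [Finset.sum, Multiset.range]

lemma betaList_succ_insert (n : ℕ) {S : Finset ℕ} (hS : n + 1 ∉ S) :
    betaList (n + 1) (insert (n + 1) S) = suffixSums (betaList n S) := by
  simp only [betaList, suffixSums, List.length_map, List.length_range]
  refine List.map_congr_left fun p hp => ?_
  rw [List.mem_range] at hp
  rw [betaLast_succ_insert n hS ⟨p, hp⟩, ← List.map_drop]
  simp [Finset.sum, Ico, LocallyFiniteOrder.finsetIco, List.range_eq_range',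
    List.drop_range']

lemma beta_succ_eq_sum (n : ℕ) (S : Finset ℕ) : beta (n + 1) S = (betaList n S).sum := by
  rw [beta_succ]
  simp [betaList, Finset.sum, Multiset.range]

lemma betaList_zero : betaList 0 ∅ = [1] := by
  decide

/-- The coordinates of `t ^ b` modulo `t ^ 2 - t + 1` in the basis `1, t`. -/
def powModSix (b : ℕ) : ℤ × ℤ :=
  match b % 6 with
  | 0 => (1, 0)
  | 1 => (0, 1)
  | 2 => (-1, 1)
  | 3 => (-1, 0)
  | 4 => (0, -1)
  | _ => (1, -1)

lemma X_pow_sub_dvd (b : ℕ) :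
    cyclotomic 6 ℤ ∣ X ^ b - (C (powModSix b).1 + C (powModSix b).2 * X) := by
  have h6 : (X ^ 2 - X + 1 : ℤ[X]) ∣ X ^ b - X ^ (b % 6) := by
    have h : (X ^ 2 - X + 1 : ℤ[X]) ∣ X ^ 6 - 1 :=
      ⟨(X + 1) * (X ^ 3 - 1), by ring⟩
    have h' := h.trans (sub_one_dvd_pow_sub_one (X ^ 6 : ℤ[X]) (b / 6))
    have e : (X ^ b - X ^ (b % 6) : ℤ[X]) = X ^ (b % 6) * ((X ^ 6) ^ (b / 6) - 1) := by
      conv_lhs => rw [← Nat.mod_add_div b 6, pow_add, pow_mul]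
      simp [mul_sub]
    exact e ▸ h'.mul_left _
  rw [cyclotomic_six]
  have hlt := Nat.mod_lt b (show 6 > 0 by norm_num)
  unfold powModSix
  generalize b % 6 = r at *
  rw [← sub_add_sub_cancel (X ^ b) (X ^ r : ℤ[X])]
  refine dvd_add h6 ?_
  interval_cases r
  · simp
  · simp
  · exact ⟨1, by simp; ring⟩
  · exact ⟨X + 1, by simp; ring⟩
  · exact ⟨X ^ 2 + X, by simp; ring⟩
  · exact ⟨X ^ 3 + X ^ 2 - 1, by simp; ring⟩

lemma dvd_sum_X_pow {ι : Type*} (s : Finset ι) (f : ι → ℕ)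
    (h : ∑ i ∈ s, powModSix (f i) = 0) : cyclotomic 6 ℤ ∣ ∑ i ∈ s, X ^ f i := by
  have h1 := congrArg Prod.fst h
  have h2 := congrArg Prod.snd h
  rw [Prod.fst_sum] at h1
  rw [Prod.snd_sum] at h2
  have hd := dvd_sum (s := s) fun i _ => X_pow_sub_dvd (f i)
  rw [sum_sub_distrib, sum_add_distrib, ← sum_mul, ← map_sum, ← map_sum, h1, h2] at hd
  simpa using hd

/-- The sum of `powModSix` of the total over all ways of applying `prefixSums` or `suffixSums`
to `l` successively `k` times. -/
def powModSixSum : ℕ → List ℕ → ℤ × ℤ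
  | 0, l => powModSix l.sum
  | k + 1, l => powModSixSum k (prefixSums l) + powModSixSum k (suffixSums l)

lemma sum_powModSix_beta (k n : ℕ) :
    ∑ S ∈ (Ico 1 (n + k + 1)).powerset, powModSix (beta (n + k + 1) S) =
      ∑ S ∈ (Ico 1 (n + 1)).powerset, powModSixSum k (betaList n S) := by
  induction k generalizing n with
  | zero => simp [powModSixSum, beta_succ_eq_sum]
  | succ k ih =>
    rw [show n + (k + 1) + 1 = (n + 1) + k + 1 by ring, ih,
      ← insert_Ico_right_eq_Ico_add_one (show 1 ≤ n + 1 by omega),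
      sum_powerset_insert (by simp), ← sum_add_distrib]
    refine sum_congr rfl fun S hS => ?_
    have hS' : n + 1 ∉ S := fun h => by simpa using mem_powerset.1 hS h
    rw [betaList_succ n hS', betaList_succ_insert n hS', powModSixSum]

lemma powModSixSum_ten : powModSixSum 10 [1] = 0 := by
  decide +kernel

/-- The sixth cyclotomic polynomial `Φ₆(t) = t² - t + 1` divides the descent
set polynomial `Q₁₁(t)`. -/
theorem cyclotomic_six_dvd_Q_eleven :
    Polynomial.cyclotomic 6 ℤ ∣ Q 11 := by
  exact dvd_sum_X_pow _ (beta 11)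
    ((sum_powModSix_beta 10 0).trans (by simp [betaList_zero, powModSixSum_ten]))
end
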